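/- Let a = 5 + √5 and b = 6 − 2√5, and let S = {(x,y) ∈ ℝ² : x > 0, y > 0, and 8x − a·y − b·x·y − a·x²·y + 8·x·y² = 0}, equipped with the subspace topology from ℝ². Then (1,1) ∈ S, and S is not a topological manifold; in particular, no neighborhood of (1,1) in S is homeomorphic to an open subset of ℝⁿ for any n. -/

import Mathlib

/-- The solution curve `8x − ay − bxy − ax²y + 8xy² = 0` (with `a = 5 + √5`,
`b = 6 − 2√5`) in the open positive quadrant. -/
noncomputable def solCurve : Set (ℝ × ℝ) :=
  {p | 0 < p.1 ∧ 0 < p.2 ∧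
    8 * p.1 - (5 + Real.sqrt 5) * p.2 - (6 - 2 * Real.sqrt 5) * p.1 * p.2 -
      (5 + Real.sqrt 5) * p.1 ^ 2 * p.2 + 8 * p.1 * p.2 ^ 2 = 0}

open Set Filter Topology

/-- The equation of `solCurve` with the variables separated. -/
theorem mem_solCurve_iff {p : ℝ × ℝ} :
    p ∈ solCurve ↔ 0 < p.1 ∧ 0 < p.2 ∧
      8 * p.1 * (p.2 - 1) ^ 2 = (5 + Real.sqrt 5) * p.2 * (p.1 - 1) ^ 2 := by
  refine and_congr_right fun _ => and_congr_right fun _ => ?_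
  constructor <;> intro h <;> linear_combination h

theorem one_mem_solCurve : ((1, 1) : ℝ × ℝ) ∈ solCurve := by
  simp [mem_solCurve_iff]

theorem fst_ne_one_and_snd_ne_one {p : ℝ × ℝ} (hp : p ∈ solCurve) (h1 : p ≠ (1, 1)) :
    p.1 ≠ 1 ∧ p.2 ≠ 1 := by
  obtain ⟨hx, hy, h⟩ := mem_solCurve_iff.1 hp
  have ha : 0 < 5 + Real.sqrt 5 := by positivity
  constructor
  · intro hx1
    have : p.2 - 1 = 0 := by simpa [hx1] using h
    exact h1 (Prod.ext hx1 (sub_eq_zero.1 this))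
  · intro hy1
    have : p.1 - 1 = 0 := by simpa [hy1, ha.ne'] using h
    exact h1 (Prod.ext (sub_eq_zero.1 this) hy1)

theorem IsPreconnected.lt_of_notMem {X : Type*} [TopologicalSpace X] {C : Set X}
    (hC : IsPreconnected C) {f : X → ℝ} (hf : Continuous f) {c : ℝ} (hc : ∀ x ∈ C, f x ≠ c)
    {x y : X} (hx : x ∈ C) (hy : y ∈ C) (h : c < f x) : c < f y := by
  by_contra! hle
  obtain ⟨z, hz, hzc⟩ := (hC.image f hf.continuousOn).ordConnected.out
    (mem_image_of_mem f hy) (mem_image_of_mem f hx) ⟨hle, h.le⟩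
  exact hc z hz hzc

/-- The points `(x, y)` of `solCurve` satisfy `y + y⁻¹ = 2 * halfTrace x`. -/
noncomputable def halfTrace (x : ℝ) : ℝ := 1 + (5 + Real.sqrt 5) * (x - 1) ^ 2 / (16 * x)

theorem one_lt_halfTrace {x : ℝ} (hx : 0 < x) (h1 : x ≠ 1) : 1 < halfTrace x := by
  have := sq_pos_of_ne_zero (sub_ne_zero.2 h1)
  have : 0 < (5 + Real.sqrt 5) * (x - 1) ^ 2 / (16 * x) := by positivity
  unfold halfTrace
  linarith

theorem mem_solCurve_of_halfTrace {x y : ℝ} (hx : 0 < x) (hy : 0 < y)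
    (h : y ^ 2 + 1 = 2 * halfTrace x * y) : (x, y) ∈ solCurve := by
  refine mem_solCurve_iff.2 ⟨hx, hy, ?_⟩
  unfold halfTrace at h
  field_simp at h
  dsimp only
  linear_combination h / 2

theorem continuousAt_halfTrace : ContinuousAt halfTrace 1 := by
  unfold halfTrace
  fun_prop (disch := norm_num)

theorem eventually_exists_branches {O : Set (ℝ × ℝ)} (hO : O ∈ 𝓝 ((1, 1) : ℝ × ℝ)) :
    ∀ᶠ x in 𝓝[≠] (1 : ℝ), (∃ y, 1 < y ∧ (x, y) ∈ solCurve ∩ O) ∧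
      ∃ y, y < 1 ∧ (x, y) ∈ solCurve ∩ O := by
  have hT := continuousAt_halfTrace
  have hT1 : halfTrace 1 = 1 := by simp [halfTrace]
  have hp : ContinuousAt (fun x => (x, halfTrace x + Real.sqrt (halfTrace x ^ 2 - 1))) 1 := by
    fun_prop
  have hm : ContinuousAt (fun x => (x, halfTrace x - Real.sqrt (halfTrace x ^ 2 - 1))) 1 := by
    fun_prop
  have hpO := hp.eventually_mem (s := O) (by simpa [hT1] using hO)
  have hmO := hm.eventually_mem (s := O) (by simpa [hT1] using hO)
  filter_upwards [hpO.filter_mono nhdsWithin_le_nhds, hmO.filter_mono nhdsWithin_le_nhds,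
    (eventually_gt_nhds zero_lt_one).filter_mono nhdsWithin_le_nhds, self_mem_nhdsWithin]
    with x hxp hxm hx hne
  have h1 := one_lt_halfTrace hx hne
  have hs : Real.sqrt (halfTrace x ^ 2 - 1) ^ 2 = halfTrace x ^ 2 - 1 :=
    Real.sq_sqrt (by nlinarith)
  have hs0 := Real.sqrt_nonneg (halfTrace x ^ 2 - 1)
  set s := Real.sqrt (halfTrace x ^ 2 - 1)
  refine ⟨⟨_, by linarith, mem_solCurve_of_halfTrace hx (by linarith) ?_, hxp⟩,
    ⟨_, by nlinarith, mem_solCurve_of_halfTrace hx (by nlinarith) ?_, hxm⟩⟩ <;>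
  linear_combination hs

/-- A punctured ball in a real normed space of dimension at least two is preconnected. -/
theorem isPreconnected_ball_diff_singleton {E : Type*} [NormedAddCommGroup E] [NormedSpace ℝ E]
    (hE : 1 < Module.rank ℝ E) (p : E) (r : ℝ) : IsPreconnected (Metric.ball p r \ {p}) := by
  have hcont : Continuous fun x : E => p + (r / (1 + ‖x‖)) • x := by
    have : ∀ x : E, 1 + ‖x‖ ≠ 0 := fun x => by positivity
    fun_prop (disch := assumption)
  obtain hr | hr := le_or_gt r 0
  · simp [Metric.ball_eq_empty.2 hr, isPreconnected_empty]
  convert (isConnected_compl_singleton_of_one_lt_rank hE (0 : E)).isPreconnected.image _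
    hcont.continuousOn using 1
  ext y
  constructor
  · rintro ⟨hy, hyp⟩
    have hlt : 0 < r - ‖y - p‖ := sub_pos.2 (mem_ball_iff_norm.1 hy)
    refine ⟨(r - ‖y - p‖)⁻¹ • (y - p), ?_, ?_⟩
    · simpa [hlt.ne', sub_eq_zero] using hyp
    · have : r / (1 + (r - ‖y - p‖)⁻¹ * ‖y - p‖) * (r - ‖y - p‖)⁻¹ = 1 := by
        have : 1 + (r - ‖y - p‖)⁻¹ * ‖y - p‖ = r * (r - ‖y - p‖)⁻¹ := by
          field_simp
          ring
        rw [this]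
        field_simp
      simp only [norm_smul, norm_inv, Real.norm_of_nonneg hlt.le, smul_smul, this, one_smul]
      abel
  · rintro ⟨x, hx, rfl⟩
    have hx0 : x ≠ 0 := hx
    have hpos : 0 < 1 + ‖x‖ := by positivity
    refine ⟨?_, ?_⟩
    · rw [mem_ball_iff_norm, add_sub_cancel_left, norm_smul, Real.norm_of_nonneg (by positivity),
        div_mul_eq_mul_div, div_lt_iff₀ hpos]
      linarith
    · simp [hr.ne', hpos.ne', hx0]

/-- A punctured ball in `ℝⁿ` is a union of at most two preconnected sets. -/
theorem exists_isPreconnected_union_eq_ball_diff_singleton {n : ℕ} (p : Fin n → ℝ) (r : ℝ) :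
    ∃ A B : Set (Fin n → ℝ), IsPreconnected A ∧ IsPreconnected B ∧
      A ∪ B = Metric.ball p r \ {p} := by
  obtain hn | hn := le_or_gt n 1
  · obtain rfl | rfl := Nat.le_one_iff_eq_zero_or_eq_one.1 hn
    · refine ⟨∅, ∅, isPreconnected_empty, isPreconnected_empty, ?_⟩
      ext x
      simp [Subsingleton.elim x p]
    · refine ⟨Metric.ball p r ∩ {x | x 0 < p 0}, Metric.ball p r ∩ {x | p 0 < x 0},
        ((convex_ball p r).inter
          (convex_halfSpace_lt (LinearMap.proj (R := ℝ) (0 : Fin 1)).isLinear _)).isPreconnected,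
        ((convex_ball p r).inter
          (convex_halfSpace_gt (LinearMap.proj (R := ℝ) (0 : Fin 1)).isLinear _)).isPreconnected,
        ?_⟩
      have hne (x : Fin 1 → ℝ) : x ≠ p ↔ x 0 ≠ p 0 := by
        simp [funext_iff]
      ext x
      rw [← inter_union_distrib_left]
      exact and_congr_right fun _ => lt_or_lt_iff_ne.trans (hne x).symm
  · refine ⟨_, ∅, isPreconnected_ball_diff_singleton ?_ p r, isPreconnected_empty, union_empty _⟩
    exact Module.one_lt_rank_of_one_lt_finrank (by simpa using hn)

/-- A preconnected part of `solCurve` avoiding `(1, 1)` lies in one of the open quadrants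
centred at `(1, 1)`. -/
theorem IsPreconnected.same_quadrant {C : Set (ℝ × ℝ)} (hC : IsPreconnected C)
    (hCS : C ⊆ solCurve \ {(1, 1)}) {p q : ℝ × ℝ} (hp : p ∈ C) (hq : q ∈ C) :
    (1 < p.1 → 1 < q.1) ∧ (1 < p.2 → 1 < q.2) :=
  have hne := fun _ hz => fst_ne_one_and_snd_ne_one (hCS hz).1 (hCS hz).2
  ⟨hC.lt_of_notMem continuous_fst (fun z hz => (hne z hz).1) hp hq,
    hC.lt_of_notMem continuous_snd (fun z hz => (hne z hz).2) hp hq⟩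

/-- Near `(1, 1)`, the curve `solCurve` punctured at `(1, 1)` is not covered by two of its
preconnected subsets. -/
theorem not_solCurve_inter_diff_subset_union {O C D : Set (ℝ × ℝ)}
    (hO : O ∈ 𝓝 ((1, 1) : ℝ × ℝ)) (hC : IsPreconnected C) (hCS : C ⊆ solCurve \ {(1, 1)})
    (hD : IsPreconnected D) (hDS : D ⊆ solCurve \ {(1, 1)}) :
    ¬ (solCurve ∩ O) \ {(1, 1)} ⊆ C ∪ D := by
  intro hsub
  have hmem : ∀ x y, x ≠ 1 → (x, y) ∈ solCurve ∩ O → (x, y) ∈ C ∨ (x, y) ∈ D :=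
    fun x y hx hxy => hsub ⟨hxy, fun h => hx (congrArg Prod.fst h)⟩
  have hev := eventually_exists_branches hO
  obtain ⟨x, ⟨⟨y, hy, hxy⟩, ⟨y', hy', hxy'⟩⟩, hx : 1 < x⟩ :=
    ((hev.filter_mono (nhdsGT_le_nhdsNE 1)).and self_mem_nhdsWithin).exists
  obtain ⟨x', ⟨⟨y'', hy'', hxy''⟩, -⟩, hx' : x' < 1⟩ :=
    ((hev.filter_mono (nhdsLT_le_nhdsNE 1)).and self_mem_nhdsWithin).exists
  have hsep {E : Set (ℝ × ℝ)} (hE : IsPreconnected E) (hES : E ⊆ solCurve \ {(1, 1)}) :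
      ((x, y) ∈ E → (x, y') ∉ E) ∧ ((x, y) ∈ E → (x', y'') ∉ E) ∧
        ((x, y') ∈ E → (x', y'') ∉ E) :=
    ⟨fun h₁ h₂ => hy'.not_gt ((hE.same_quadrant hES h₁ h₂).2 hy),
      fun h₁ h₂ => hx'.not_gt ((hE.same_quadrant hES h₁ h₂).1 hx),
      fun h₁ h₂ => hx'.not_gt ((hE.same_quadrant hES h₁ h₂).1 hx)⟩
  obtain ⟨c₁, c₂, c₃⟩ := hsep hC hCS
  obtain ⟨d₁, d₂, d₃⟩ := hsep hD hDS
  rcases hmem _ _ hx.ne' hxy with h₁ | h₁ <;> rcases hmem _ _ hx.ne' hxy' with h₂ | h₂ <;>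
    rcases hmem _ _ hx'.ne hxy'' with h₃ | h₃
  exacts [c₁ h₁ h₂, c₁ h₁ h₂, c₂ h₁ h₃, d₃ h₂ h₃, c₃ h₂ h₃, d₂ h₁ h₃, d₁ h₁ h₂, d₁ h₁ h₂]

theorem not_nonempty_homeomorph_solCurve_inter {n : ℕ} {U : Set (ℝ × ℝ)} (hU : IsOpen U)
    (h1U : ((1, 1) : ℝ × ℝ) ∈ U) {V : Set (Fin n → ℝ)} (hV : IsOpen V) :
    ¬ Nonempty (↥(solCurve ∩ U) ≃ₜ ↥V) := by
  rintro ⟨h⟩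
  obtain ⟨o, ho⟩ : ∃ o : ↥(solCurve ∩ U), o.1 = (1, 1) := ⟨⟨_, one_mem_solCurve, h1U⟩, rfl⟩
  obtain ⟨r, hr, hrV⟩ := Metric.isOpen_iff.1 hV (h o) (h o).2
  obtain ⟨A, B, hA, hB, hAB⟩ :=
    exists_isPreconnected_union_eq_ball_diff_singleton (h o : Fin n → ℝ) r
  have hpre : (fun z => (h z : Fin n → ℝ)) ⁻¹' Metric.ball (h o) r ∈ 𝓝 o :=
    (continuous_subtype_val.comp h.continuous).continuousAt.preimage_mem_nhds
      (Metric.ball_mem_nhds _ hr)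
  obtain ⟨O, hO, hOsub⟩ := (mem_nhds_subtype _ _ _).1 hpre
  rw [ho] at hO
  have hpiece : ∀ C ⊆ A ∪ B, IsPreconnected C →
      IsPreconnected ((fun v => (h.symm v : ℝ × ℝ)) '' (Subtype.val ⁻¹' C)) ∧
        (fun v => (h.symm v : ℝ × ℝ)) '' (Subtype.val ⁻¹' C) ⊆ solCurve \ {(1, 1)} := by
    intro C hCsub hC
    rw [hAB] at hCsub
    constructor
    · refine IsPreconnected.image ?_ _ (continuous_subtype_val.comp h.symm.continuous).continuousOn
      rwa [← IsInducing.subtypeVal.isPreconnected_image, Subtype.image_preimage_coe,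
        inter_eq_right.2 (hCsub.trans (sdiff_subset.trans hrV))]
    · rintro _ ⟨v, hv, rfl⟩
      refine ⟨(h.symm v).2.1, fun hv1 => (hCsub hv).2 ?_⟩
      have hvo : h.symm v = o := Subtype.ext (hv1.trans ho.symm)
      rw [← hvo, h.apply_symm_apply]
      rfl
  obtain ⟨hA₁, hA₂⟩ := hpiece A subset_union_left hA
  obtain ⟨hB₁, hB₂⟩ := hpiece B subset_union_right hB
  refine not_solCurve_inter_diff_subset_union (inter_mem hO (hU.mem_nhds h1U))
    hA₁ hA₂ hB₁ hB₂ ?_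
  rintro p ⟨⟨hpS, hpO, hpU⟩, hp1⟩
  have hmem : (h ⟨p, hpS, hpU⟩ : Fin n → ℝ) ∈ A ∪ B := by
    rw [hAB]
    refine ⟨hOsub hpO, fun heq => hp1 ?_⟩
    have hpo := h.injective (Subtype.ext heq)
    exact (congrArg Subtype.val hpo).trans ho
  exact hmem.imp (fun hz => ⟨_, hz, by simp⟩) fun hz => ⟨_, hz, by simp⟩

/-- The curve `solCurve` contains `(1,1)` and is not a topological manifold: no
neighborhood of `(1,1)` in it is homeomorphic to an open subset of `ℝⁿ` for any `n`. -/
theorem solCurve_not_manifold :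
    ((1, 1) : ℝ × ℝ) ∈ solCurve ∧
    (¬ ∀ x ∈ solCurve, ∃ (n : ℕ) (U : Set (ℝ × ℝ)), IsOpen U ∧ x ∈ U ∧
      ∃ V : Set (Fin n → ℝ), IsOpen V ∧ Nonempty (↥(solCurve ∩ U) ≃ₜ ↥V)) ∧
    (∀ (n : ℕ) (U : Set (ℝ × ℝ)), IsOpen U → ((1, 1) : ℝ × ℝ) ∈ U →
      ¬ ∃ V : Set (Fin n → ℝ), IsOpen V ∧ Nonempty (↥(solCurve ∩ U) ≃ₜ ↥V)) := by
  refine ⟨one_mem_solCurve, fun h => ?_, ?_⟩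
  · obtain ⟨n, U, hU, h1U, V, hV, hUV⟩ := h _ one_mem_solCurve
    exact not_nonempty_homeomorph_solCurve_inter hU h1U hV hUV
  · rintro n U hU h1U ⟨V, hV, hUV⟩
    exact not_nonempty_homeomorph_solCurve_inter hU h1U hV hUV
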